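/- Let n ≥ 3 be odd and let G ∈ ℤ^n be the vector with G_i = (−1)^{(i−1)/2} for i odd (including i = n) and G_i = 0 for i even. Let Φ ⊆ ℤ^n be the set of almost positive roots of type C_n in simple-root coordinates (with α_n the long simple root): Φ = {−e_i : 1 ≤ i ≤ n} ∪ {e_i + ⋯ + e_{j−1} : 1 ≤ i < j ≤ n} ∪ {e_i + ⋯ + e_{j−1} + 2e_j + ⋯ + 2e_{n−1} + e_n : 1 ≤ i ≤ j ≤ n}, and for α ∈ Φ set d(α) = −Σ_{l=1}^n α_l·G_l. Then d(α) ∈ {−1, 0, 1} for every α ∈ Φ, and the number of α ∈ Φ with d(α) = 1 is ((n+1)/2)², with d(α) = 0 is (n+1)(n−1)/2, and with d(α) = −1 is ((n+1)/2)². In particular this grading of the coefficient-free type C_n cluster algebra is balanced. -/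

import Mathlib

open Matrix

/-- The type `C_n` grading vector: in 1-based terms, `G_i = (-1)^((i-1)/2)` for `i` odd
(including `i = n`) and `G_i = 0` for `i` even. -/
def gC (n : ℕ) : Fin n → ℤ := fun i =>
  if (i : ℕ) % 4 = 0 then 1 else if (i : ℕ) % 4 = 2 then -1 else 0

/-- The negative simple root `-e_i` in simple-root coordinates. -/
def negRoot {n : ℕ} (i : Fin n) : Fin n → ℤ := fun l => if l = i then -1 else 0

/-- The positive root `e_i + ⋯ + e_{j-1}` of type `C_n` (0-based half-open interval,
for pairs `i < j`). -/
def intRootCO {n : ℕ} (i j : Fin n) : Fin n → ℤ := fun l => if i ≤ l ∧ l < j then 1 else 0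

/-- The positive root `e_i + ⋯ + e_{j-1} + 2e_j + ⋯ + 2e_{n-1} + e_n` of type `C_n`
(1-based, `i ≤ j ≤ n`), written for 0-based pairs `i ≤ j`. -/
def longRootC (n : ℕ) (i j : Fin n) : Fin n → ℤ := fun l =>
  if (l : ℕ) = n - 1 then 1 else if i ≤ l ∧ l < j then 1 else if j ≤ l then 2 else 0

/-- The almost positive roots of type `C_n` in simple-root coordinates. -/
def PhiC (n : ℕ) : Finset (Fin n → ℤ) :=
  (Finset.univ.image negRoot) ∪
    (((Finset.univ ×ˢ Finset.univ).filter (fun p : Fin n × Fin n => p.1 < p.2)).image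
      (fun p => intRootCO p.1 p.2)) ∪
    (((Finset.univ ×ˢ Finset.univ).filter (fun p : Fin n × Fin n => p.1 ≤ p.2)).image
      (fun p => longRootC n p.1 p.2))

/-- The degree `d(α) = -∑ l, α_l G_l`. -/
def degC (n : ℕ) (α : Fin n → ℤ) : ℤ := -∑ l, α l * gC n l

/-- grading on naturals -/
def gN (l : ℕ) : ℤ := if l % 4 = 0 then 1 else if l % 4 = 2 then -1 else 0

/-- prefix sums of the grading -/
def pN (k : ℕ) : ℤ := if k % 4 = 1 ∨ k % 4 = 2 then 1 else 0

theorem pN_succ (k : ℕ) : pN (k + 1) = pN k + gN k := by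
  unfold pN gN
  split_ifs <;> omega

theorem pN_cases (k : ℕ) : pN k = 0 ∨ pN k = 1 := by
  unfold pN
  split_ifs <;> simp

theorem sum_tail (i N : ℕ) :
    ∑ l ∈ Finset.range N, (if i ≤ l then gN l else 0) = pN N - pN (min i N) := by
  induction N with
  | zero => simp
  | succ N ih =>
    rw [Finset.sum_range_succ, ih, pN_succ]
    by_cases h : i ≤ N
    · rw [if_pos h, min_eq_left h, min_eq_left (by omega)]; ring
    · rw [if_neg h, min_eq_right (by omega), min_eq_right (by omega), pN_succ]; ring

theorem deg_neg {n : ℕ} (i : Fin n) : degC n (negRoot i) = gN i := by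
  unfold degC negRoot
  simp only [ite_mul, zero_mul, Finset.sum_ite_eq', Finset.mem_univ, if_true]
  simp only [gC, gN]
  split_ifs <;> rfl

theorem deg_int {n : ℕ} (i j : Fin n) (h : i < j) :
    degC n (intRootCO i j) = pN i - pN j := by
  unfold degC intRootCO
  have h1 := sum_tail i n
  have h2 := sum_tail j n
  rw [min_eq_left (by omega)] at h1 h2
  have : ∑ l : Fin n, (if i ≤ l ∧ l < j then (1 : ℤ) else 0) * gC n l
      = ∑ l ∈ Finset.range n, ((if (i : ℕ) ≤ l then gN l else 0) - (if (j : ℕ) ≤ l then gN l else 0)) := by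
    rw [← Fin.sum_univ_eq_sum_range
      (fun l => ((if (i : ℕ) ≤ l then gN l else 0) - (if (j : ℕ) ≤ l then gN l else 0)))]
    refine Finset.sum_congr rfl fun l _ => ?_
    have : gC n l = gN l := rfl
    rw [this]
    simp only [Fin.le_def, Fin.lt_def] at *
    split_ifs <;> omega
  rw [this, Finset.sum_sub_distrib, h1, h2]
  ring

theorem deg_long {n : ℕ} (hn : n % 2 = 1) (i j : Fin n) (h : i ≤ j) :
    degC n (longRootC n i j) = pN i + pN j - 1 := by
  unfold degC longRootC
  have h1 := sum_tail i (n - 1)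
  have h2 := sum_tail j (n - 1)
  rw [min_eq_left (by omega)] at h1 h2
  have : ∑ l : Fin n, (if (l : ℕ) = n - 1 then (1 : ℤ) else if i ≤ l ∧ l < j then 1 else
        if j ≤ l then 2 else 0) * gC n l
      = ∑ l ∈ Finset.range n, (if l = n - 1 then gN l else
        ((if (i : ℕ) ≤ l then gN l else 0) + (if (j : ℕ) ≤ l then gN l else 0))) := by
    rw [← Fin.sum_univ_eq_sum_range (fun l => (if l = n - 1 then gN l else
        ((if (i : ℕ) ≤ l then gN l else 0) + (if (j : ℕ) ≤ l then gN l else 0))))]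
    refine Finset.sum_congr rfl fun l _ => ?_
    have : gC n l = gN l := rfl
    rw [this]
    simp only [Fin.le_def, Fin.lt_def] at *
    split_ifs <;> omega
  rw [this]
  obtain ⟨m, rfl⟩ : ∃ m, n = m + 1 := ⟨n - 1, by omega⟩
  simp only [Nat.add_sub_cancel] at *
  rw [Finset.sum_range_succ, if_pos rfl]
  have e : ∑ l ∈ Finset.range m, (if l = m then gN l else
        ((if (i : ℕ) ≤ l then gN l else 0) + (if (j : ℕ) ≤ l then gN l else 0)))
      = ∑ l ∈ Finset.range m,
        ((if (i : ℕ) ≤ l then gN l else 0) + (if (j : ℕ) ≤ l then gN l else 0)) := by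
    refine Finset.sum_congr rfl fun l hl => ?_
    rw [if_neg (by simp at hl; omega)]
  rw [e, Finset.sum_add_distrib, h1, h2]
  have : 2 * pN m + gN m = 1 := by
    unfold pN gN
    split_ifs <;> omega
  linarith

theorem inj_neg {n : ℕ} : Function.Injective (negRoot : Fin n → Fin n → ℤ) := by
  intro i j h
  have := congrFun h i
  by_contra hij
  simp [negRoot, hij] at this

theorem inj_int {n : ℕ} (i j i' j' : Fin n) (h : i < j) (h' : i' < j')
    (e : intRootCO i j = intRootCO i' j') : i = i' ∧ j = j' := by
  have a1 := congrFun e i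
  have a2 := congrFun e i'
  have a3 := congrFun e j
  have a4 := congrFun e j'
  simp only [intRootCO, Fin.le_def, Fin.lt_def, Fin.ext_iff] at *
  constructor <;> split_ifs at * <;> omega

theorem inj_long {n : ℕ} (i j i' j' : Fin n) (h : i ≤ j) (h' : i' ≤ j')
    (e : longRootC n i j = longRootC n i' j') : i = i' ∧ j = j' := by
  have a1 := congrFun e i
  have a2 := congrFun e i'
  have a3 := congrFun e j
  have a4 := congrFun e j'
  simp only [longRootC, Fin.le_def, Fin.lt_def, Fin.ext_iff] at *
  constructor
  · clear a3 a4
    split_ifs at * <;> omega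
  · clear a1 a2
    split_ifs at * <;> omega

theorem pairs_card (n : ℕ) (Q : ℕ → ℕ → Prop) [∀ i j, Decidable (Q i j)] :
    ((Finset.univ ×ˢ Finset.univ).filter (fun p : Fin n × Fin n => Q p.1 p.2)).card
      = ∑ j ∈ Finset.range n, ∑ i ∈ Finset.range n, if Q i j then 1 else 0 := by
  rw [Finset.card_filter, Finset.sum_product_right,
    ← Fin.sum_univ_eq_sum_range (fun j => ∑ i ∈ Finset.range n, if Q i j then 1 else 0)]
  refine Finset.sum_congr rfl fun j _ => ?_
  rw [← Fin.sum_univ_eq_sum_range (fun i => if Q i j then 1 else 0)]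

theorem inner_sumC (n j d : ℕ) (hj : j + d ≤ n) (R : ℕ → Prop) [DecidablePred R] :
    (∑ i ∈ Finset.range n, if i < j + d ∧ R i then 1 else 0)
      = ∑ i ∈ Finset.range (j + d), if R i then 1 else 0 := by
  rw [← Finset.sum_subset (Finset.range_mono hj)]
  · refine Finset.sum_congr rfl fun i hi => ?_
    simp [Finset.mem_range.1 hi]
  · intro i _ hi
    rw [if_neg]
    simp at hi
    omega

theorem card_main (n : ℕ) (hn : n % 2 = 1) (d : ℤ) :
    ((PhiC n).filter (fun α => degC n α = d)).card =
      ∑ j ∈ Finset.range n, ((if gN j = d then 1 else 0)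
        + (∑ i ∈ Finset.range j, if pN i - pN j = d then 1 else 0)
        + (∑ i ∈ Finset.range (j + 1), if pN i + pN j - 1 = d then 1 else 0)) := by
  have c1 : ((Finset.univ.image (negRoot : Fin n → Fin n → ℤ)).filter
      (fun α => degC n α = d)).card = ∑ j ∈ Finset.range n, (if gN j = d then 1 else 0) := by
    rw [Finset.filter_image, Finset.card_image_of_injective _ inj_neg, Finset.card_filter,
      ← Fin.sum_univ_eq_sum_range (fun j => if gN j = d then 1 else 0)]
    simp only [deg_neg]
  have c2 : ((((Finset.univ ×ˢ Finset.univ).filter (fun p : Fin n × Fin n => p.1 < p.2)).image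
      (fun p => intRootCO p.1 p.2)).filter (fun α => degC n α = d)).card
      = ∑ j ∈ Finset.range n, (∑ i ∈ Finset.range j, if pN i - pN j = d then 1 else 0) := by
    rw [Finset.filter_image, Finset.card_image_of_injOn, Finset.filter_filter]
    · have := pairs_card n (fun i j => i < j ∧ pN i - pN j = d)
      have e : ∀ j ∈ Finset.range n, (∑ i ∈ Finset.range n, if i < j ∧ pN i - pN j = d then 1 else 0)
        = ∑ i ∈ Finset.range j, if pN i - pN j = d then 1 else 0 := fun j hj =>
          inner_sumC n j 0 (by simp at hj; omega) (fun i => pN i - pN j = d)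
      rw [← Finset.sum_congr rfl e, ← this]
      congr 1
      refine Finset.filter_congr fun p _ => ?_
      exact and_congr_right fun h => by rw [deg_int _ _ h]
    · rintro ⟨i, j⟩ h ⟨i', j'⟩ h' e
      simp at h h'
      obtain ⟨rfl, rfl⟩ := inj_int i j i' j' h.1 h'.1 e
      rfl
  have c3 : ((((Finset.univ ×ˢ Finset.univ).filter (fun p : Fin n × Fin n => p.1 ≤ p.2)).image
      (fun p => longRootC n p.1 p.2)).filter (fun α => degC n α = d)).card
      = ∑ j ∈ Finset.range n,
        (∑ i ∈ Finset.range (j + 1), if pN i + pN j - 1 = d then 1 else 0) := by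
    rw [Finset.filter_image, Finset.card_image_of_injOn, Finset.filter_filter]
    · have := pairs_card n (fun i j => i < j + 1 ∧ pN i + pN j - 1 = d)
      have e : ∀ j ∈ Finset.range n,
        (∑ i ∈ Finset.range n, if i < j + 1 ∧ pN i + pN j - 1 = d then 1 else 0)
        = ∑ i ∈ Finset.range (j + 1), if pN i + pN j - 1 = d then 1 else 0 := fun j hj =>
          inner_sumC n j 1 (by simp at hj; omega) (fun i => pN i + pN j - 1 = d)
      rw [← Finset.sum_congr rfl e, ← this]
      congr 1
      refine Finset.filter_congr fun p _ => ?_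
      have : p.1 ≤ p.2 ↔ (p.1 : ℕ) < p.2 + 1 := by
        rw [Fin.le_def]; omega
      rw [← this]
      exact and_congr_right fun h => by rw [deg_long hn _ _ h]
    · rintro ⟨i, j⟩ h ⟨i', j'⟩ h' e
      simp at h h'
      obtain ⟨rfl, rfl⟩ := inj_long i j i' j' h.1 h'.1 e
      rfl
  unfold PhiC
  rw [Finset.filter_union, Finset.filter_union, Finset.card_union_of_disjoint,
    Finset.card_union_of_disjoint, c1, c2, c3, Finset.sum_add_distrib, Finset.sum_add_distrib]
  · refine Finset.disjoint_filter_filter ?_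
    rw [Finset.disjoint_left]
    intro α h h'
    simp only [Finset.mem_image, Finset.mem_filter, Finset.mem_univ, true_and] at h h'
    obtain ⟨i, rfl⟩ := h
    obtain ⟨p, _, e⟩ := h'
    have := congrFun e i
    simp only [intRootCO, negRoot] at this
    split_ifs at this <;> omega
  · rw [← Finset.filter_union]
    refine Finset.disjoint_filter_filter ?_
    rw [Finset.disjoint_left]
    intro α h h'
    simp only [Finset.mem_image, Finset.mem_filter, Finset.mem_univ, true_and,
      Finset.mem_union] at h h'
    obtain ⟨q, _, rfl⟩ := h'
    rcases h with ⟨i, e⟩ | ⟨p, _, e⟩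
    · have := congrFun e ⟨n - 1, by omega⟩
      simp only [longRootC, negRoot] at this
      split_ifs at this <;> omega
    · have := congrFun e ⟨n - 1, by omega⟩
      simp only [longRootC, intRootCO, Fin.le_def, Fin.lt_def] at this
      split_ifs at this <;> omega

/-- number of prefix sums equal to `1` -/
def aN (k : ℕ) : ℕ := 2 * (k / 4) + (k % 4 - 1)

theorem sum_one (k : ℕ) : (∑ i ∈ Finset.range k, if pN i = 1 then 1 else 0) = aN k := by
  induction k with
  | zero => rfl
  | succ k ih =>
    rw [Finset.sum_range_succ, ih]
    unfold aN pN
    split_ifs <;> omega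

theorem sum_zero (k : ℕ) : (∑ i ∈ Finset.range k, if pN i = 0 then 1 else 0) = k - aN k := by
  induction k with
  | zero => rfl
  | succ k ih =>
    rw [Finset.sum_range_succ, ih]
    unfold aN pN
    split_ifs <;> omega

theorem term_eq (j : ℕ) (d : ℤ) :
    ((if gN j = d then 1 else 0)
        + (∑ i ∈ Finset.range j, if pN i - pN j = d then 1 else 0)
        + (∑ i ∈ Finset.range (j + 1), if pN i + pN j - 1 = d then 1 else 0) : ℕ)
    = (if gN j = d then 1 else 0) + (if 2 * pN j - 1 = d then 1 else 0)
      + ∑ i ∈ Finset.range j, ((if pN i = d then 1 else 0) + (if pN i = d + 1 then 1 else 0)) := by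
  rw [Finset.sum_range_succ, Finset.sum_add_distrib, ← two_mul]
  have e : ∀ i, (pN i - 1 = d) ↔ pN i = d + 1 := fun i => by omega
  rcases pN_cases j with h | h <;> simp only [h, sub_zero, add_zero, add_sub_cancel_right, e] <;> ring

theorem term_pos (j : ℕ) : ((if gN j = 1 then 1 else 0) + (if 2 * pN j - 1 = 1 then 1 else 0)
      + ∑ i ∈ Finset.range j, ((if pN i = 1 then 1 else 0) + (if pN i = 1 + 1 then 1 else 0)) : ℕ)
      = j / 2 + 1 := by
  have e : ∀ i, ¬ (pN i = 1 + 1) := fun i => by rcases pN_cases i with h | h <;> omega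
  simp only [e, if_false, add_zero, sum_one]
  have h4 : j % 4 = 0 ∨ j % 4 = 1 ∨ j % 4 = 2 ∨ j % 4 = 3 := by omega
  unfold aN pN gN
  rcases h4 with h | h | h | h <;> norm_num [h] <;> omega

theorem term_negd (j : ℕ) : ((if gN j = -1 then 1 else 0) + (if 2 * pN j - 1 = -1 then 1 else 0)
      + ∑ i ∈ Finset.range j, ((if pN i = -1 then 1 else 0) + (if pN i = -1 + 1 then 1 else 0)) : ℕ)
      = j / 2 + 1 := by
  have e : ∀ i, ¬ (pN i = -1) := fun i => by rcases pN_cases i with h | h <;> omega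
  simp only [e, if_false, zero_add, neg_add_cancel, sum_zero]
  have h4 : j % 4 = 0 ∨ j % 4 = 1 ∨ j % 4 = 2 ∨ j % 4 = 3 := by omega
  unfold aN pN gN
  rcases h4 with h | h | h | h <;> norm_num [h] <;> omega

theorem term_zero (j : ℕ) : ((if gN j = 0 then 1 else 0) + (if 2 * pN j - 1 = 0 then 1 else 0)
      + ∑ i ∈ Finset.range j, ((if pN i = 0 then 1 else 0) + (if pN i = 0 + 1 then 1 else 0)) : ℕ)
      = j + j % 2 := by
  rw [Finset.sum_add_distrib, sum_zero, zero_add, sum_one]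
  have h4 : j % 4 = 0 ∨ j % 4 = 1 ∨ j % 4 = 2 ∨ j % 4 = 3 := by omega
  unfold aN pN gN
  rcases h4 with h | h | h | h <;> norm_num [h] <;> omega

theorem sum_half (k : ℕ) : ∑ j ∈ Finset.range (2 * k + 1), (j / 2 + 1) = (k + 1) ^ 2 := by
  induction k with
  | zero => rfl
  | succ k ih =>
    rw [show 2 * (k + 1) + 1 = 2 * k + 1 + 1 + 1 by ring, Finset.sum_range_succ,
      Finset.sum_range_succ, ih, show (2 * k + 1) / 2 = k by omega,
      show (2 * k + 1 + 1) / 2 = k + 1 by omega]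
    ring

theorem sum_par (k : ℕ) : ∑ j ∈ Finset.range (2 * k + 1), (j + j % 2) = (k + 1) * (2 * k) := by
  induction k with
  | zero => rfl
  | succ k ih =>
    rw [show 2 * (k + 1) + 1 = 2 * k + 1 + 1 + 1 by ring, Finset.sum_range_succ,
      Finset.sum_range_succ, ih, show (2 * k + 1) % 2 = 1 by omega,
      show (2 * k + 1 + 1) % 2 = 0 by omega]
    ring

/-- for odd `n ≥ 3`, all degrees lie in `{-1, 0, 1}`, with `((n+1)/2)²`
roots of degree `1`, `(n+1)(n-1)/2` of degree `0`, and `((n+1)/2)²` of degree `-1`.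
In particular this grading of the coefficient-free type `C_n` cluster algebra is balanced. -/
theorem degree_distribution_C (n : ℕ) (hn3 : 3 ≤ n) (hn : n % 2 = 1) :
    (∀ α ∈ PhiC n, degC n α ∈ ({-1, 0, 1} : Set ℤ)) ∧
    ((PhiC n).filter (fun α => degC n α = 1)).card = ((n + 1) / 2) ^ 2 ∧
    ((PhiC n).filter (fun α => degC n α = 0)).card = (n + 1) * (n - 1) / 2 ∧
    ((PhiC n).filter (fun α => degC n α = -1)).card = ((n + 1) / 2) ^ 2 := by
  refine ⟨?_, ?_, ?_, ?_⟩
  · intro α h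
    simp only [PhiC, Finset.mem_image, Finset.mem_filter, Finset.mem_univ, true_and,
      Finset.mem_union] at h
    simp only [Set.mem_insert_iff, Set.mem_singleton_iff]
    rcases h with (⟨i, rfl⟩ | ⟨p, hp, rfl⟩) | ⟨p, hp, rfl⟩
    · rw [deg_neg]
      unfold gN
      split_ifs <;> simp
    · rw [deg_int _ _ hp.2]
      rcases pN_cases p.1 with h | h <;> rcases pN_cases p.2 with h' | h' <;> simp [h, h']
    · rw [deg_long hn _ _ hp.2]
      rcases pN_cases p.1 with h | h <;> rcases pN_cases p.2 with h' | h' <;> simp [h, h']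
  all_goals
    rw [card_main n hn]
    simp only [term_eq, term_pos, term_negd, term_zero]
    obtain ⟨k, rfl⟩ : ∃ k, n = 2 * k + 1 := ⟨n / 2, by omega⟩
  · rw [sum_half, show (2 * k + 1 + 1) / 2 = k + 1 by omega]
  · rw [sum_par, show (2 * k + 1 + 1) * (2 * k + 1 - 1) = 2 * ((k + 1) * (2 * k)) by
      rw [Nat.add_sub_cancel]; ring]
    omega
  · rw [sum_half, show (2 * k + 1 + 1) / 2 = k + 1 by omega]
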